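/- Let n ≥ 3 be an odd natural number. Then the rank of the multiplicative group K_n satisfies rk(K_n) ≥ φ(n)/2 − (φ(n)/(2|U_n|) − 1), where φ is Euler's totient function. Moreover, rk(K_1) = 1. -/

import Mathlib

open scoped BigOperators

/-- The minimal `k ≥ 1` such that `2^k ≡ ±1 (mod n)`. -/
noncomputable def Upow (n : ℕ) : ℕ :=
  sInf {k : ℕ | 1 ≤ k ∧ ((2 : ZMod n) ^ k = 1 ∨ (2 : ZMod n) ^ k = -1)}

/-- The set `U_n = {1, 2, 4, …, 2^{k-1}} ⊆ ℤ/nℤ`. -/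
noncomputable def Uset (n : ℕ) : Finset (ZMod n) :=
  (Finset.range (Upow n)).image (fun i => (2 : ZMod n) ^ i)

/-- `ω_n = e^{2πi/n}`. -/
noncomputable def omegaC (n : ℕ) : ℂ := Complex.exp (2 * Real.pi * Complex.I / n)

/-- `K_n`: the multiplicative subgroup of `ℂˣ` generated by `{1 + ω_n^j : 0 ≤ j < n}`. -/
noncomputable def Kgroup (n : ℕ) : Subgroup ℂˣ :=
  Subgroup.closure {u : ℂˣ | ∃ j < n, (u : ℂ) = 1 + omegaC n ^ j}

section

open Filter Topology Set MeasureTheory Asymptotics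

section
open Complex

theorem one_sub_mul_exp_mem_slitPlane {z : ℂ} (hz : ‖z‖ = 1) (hz1 : z ≠ 1) {t : ℝ} (ht : 0 ≤ t) :
    1 - z * cexp (-t) ∈ slitPlane := by
  have hre : z.re < 1 := by
    refine lt_of_le_of_ne (hz ▸ re_le_norm z) fun h => hz1 ?_
    have h2 : z.re ^ 2 + z.im ^ 2 = 1 := by
      have := Complex.sq_norm z
      rw [hz, normSq_apply] at this; linarith
    rw [h] at h2
    exact Complex.ext (by simpa using h) (by simpa using h2)
  left
  have e : cexp (-t) = ((Real.exp (-t) : ℝ) : ℂ) := by push_cast; rfl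
  rw [e, sub_re, one_re, re_mul_ofReal]
  have h1 : Real.exp (-t) ≤ 1 := Real.exp_le_one_iff.2 (by linarith)
  have h0 := Real.exp_pos (-t)
  nlinarith

theorem hasDerivAt_log_one_sub_mul_exp {z : ℂ} {t : ℝ} (h : 1 - z * cexp (-t) ∈ slitPlane) :
    HasDerivAt (fun t : ℝ => log (1 - z * cexp (-t)))
      (z * cexp (-t) / (1 - z * cexp (-t))) t := by
  have h1 : HasDerivAt (fun t : ℝ => cexp (-t)) (cexp (-t) * (-1)) t :=
    ((hasDerivAt_id t).ofReal_comp.neg).cexp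
  have h2 := ((h1.const_mul z).const_sub 1).clog_real h
  convert h2 using 1
  ring

theorem expZeta_one_eq_neg_log {x : ℝ} (hx : (x : UnitAddCircle) ≠ 0) :
    HurwitzZeta.expZeta x 1 = -log (1 - cexp (2 * Real.pi * I * x)) := by
  set z := cexp (2 * Real.pi * I * x) with hzdef
  have hz : ‖z‖ = 1 := by
    rw [hzdef, show (2 * Real.pi * I * x : ℂ) = ((2 * Real.pi * x : ℝ) : ℂ) * I by push_cast; ring]
    exact norm_exp_ofReal_mul_I _
  have hz1 : z ≠ 1 := by
    intro h
    apply hx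
    obtain ⟨m, hm⟩ := Complex.exp_eq_one_iff.1 h
    rw [show (2 * Real.pi * I * x : ℂ) = x * (2 * Real.pi * I) by ring] at hm
    have : (x : ℂ) = m := mul_right_cancel₀ Complex.two_pi_I_ne_zero hm
    have : x = m := by exact_mod_cast this
    rw [this]
    exact (AddCircle.coe_eq_zero_iff 1).2 ⟨m, by simp⟩
  set F : ℝ → ℂ := fun t => z * cexp (-t) / (1 - z * cexp (-t)) with hF
  have hslit : ∀ t : ℝ, 0 ≤ t → 1 - z * cexp (-t) ∈ slitPlane := fun t ht =>
    one_sub_mul_exp_mem_slitPlane hz hz1 ht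
  have hcont : ∀ t : ℝ, 0 ≤ t → ContinuousAt F t := fun t ht => by
    refine ContinuousAt.div (by fun_prop) (by fun_prop) (slitPlane_ne_zero (hslit t ht))
  have hloc : LocallyIntegrableOn F (Ioi 0) :=
    ContinuousOn.locallyIntegrableOn (fun t ht => (hcont t (le_of_lt ht)).continuousWithinAt)
      measurableSet_Ioi
  have hexp0 : Tendsto (fun t : ℝ => 1 - z * cexp (-t)) atTop (𝓝 1) := by
    have : Tendsto (fun t : ℝ => ((Real.exp (-t) : ℝ) : ℂ)) atTop (𝓝 ((0 : ℝ) : ℂ)) :=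
      (continuous_ofReal.tendsto 0).comp
        (Real.tendsto_exp_atBot.comp tendsto_neg_atTop_atBot)
    have h2 := (this.const_mul z).const_sub 1
    simpa using h2
  have htop : F =O[atTop] fun t => Real.exp (-1 * t) := by
    have h1 : (fun t : ℝ => z * cexp (-t)) =O[atTop] fun t => Real.exp (-1 * t) := by
      refine IsBigO.of_bound 1 (Eventually.of_forall fun t => ?_)
      simp [hz, Complex.norm_exp]
    have h2 : (fun t : ℝ => (1 - z * cexp (-t))⁻¹) =O[atTop] fun _ => (1 : ℝ) :=
      (hexp0.inv₀ one_ne_zero).isBigO_one ℝ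
    simpa [hF, div_eq_mul_inv] using h1.mul h2
  have hbot : F =O[𝓝[>] 0] fun t => t ^ (-(0 : ℝ)) := by
    have : F =O[𝓝[>] 0] fun _ => (1 : ℝ) :=
      (((hcont 0 le_rfl).tendsto.mono_left nhdsWithin_le_nhds)).isBigO_one ℝ
    simpa using this
  have hmel : mellin F 1 = -log (1 - z) := by
    have hint : IntegrableOn F (Ioi 0) := by
      have := mellinConvergent_of_isBigO_rpow_exp one_pos hloc htop hbot (s := 1) (by simp)
      simpa [MellinConvergent] using this
    have := integral_Ioi_of_hasDerivAt_of_tendsto' (a := 0) (m := 0)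
      (fun t ht => hasDerivAt_log_one_sub_mul_exp (hslit t ht)) hint
      (by simpa using hexp0.clog one_mem_slitPlane)
    simpa [mellin] using this
  have hdir : ∀ s : ℂ, 1 < s.re → mellin F s = Gamma s * HurwitzZeta.expZeta x s := by
    intro s hs
    have hsum : HasSum (fun i : ℕ => Gamma s * z ^ (i + 1) / ((i + 1 : ℝ) : ℂ) ^ s) (mellin F s) := by
      refine hasSum_mellin (p := fun i : ℕ => (i + 1 : ℝ)) (fun i => Or.inr (by positivity))
        (by linarith) (fun t ht => ?_) ?_
      · have hlt : ‖z * cexp (-t)‖ < 1 := by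
          simpa [hz, Complex.norm_exp] using ht
        have := (hasSum_geometric_of_norm_lt_one hlt).mul_left (z * cexp (-t))
        rw [← div_eq_mul_inv] at this
        refine this.congr_fun fun i => ?_
        rw [← pow_succ', mul_pow, ← Complex.exp_nat_mul (-t : ℂ)]
        congr 1
        push_cast
        ring_nf
      · simp only [norm_pow, hz, one_pow]
        have := (summable_nat_add_iff 1).2 (Real.summable_one_div_nat_rpow.2 hs)
        simpa using this
    have h2 := (HurwitzZeta.hasSum_expZeta_of_one_lt_re x hs).mul_left (Gamma s)
    rw [← hasSum_nat_add_iff' 1] at h2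
    have hs0 : s ≠ 0 := by rintro rfl; norm_num at hs
    simp only [Finset.range_one, Finset.sum_singleton, Nat.cast_zero, zero_cpow hs0, div_zero,
      mul_zero, sub_zero] at h2
    refine hsum.unique (h2.congr_fun fun i => ?_)
    rw [hzdef, ← Complex.exp_nat_mul, mul_div_assoc]
    push_cast
    ring_nf
  have hc1 : ContinuousAt (mellin F) 1 :=
    (mellin_differentiableAt_of_isBigO_rpow_exp one_pos hloc htop hbot (by simp)).continuousAt
  have hc2 : ContinuousAt (fun s => Gamma s * HurwitzZeta.expZeta x s) 1 :=
    ((differentiableAt_Gamma 1 fun m h => by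
      have := congrArg re h
      simp at this; have : (0 : ℝ) ≤ m := m.cast_nonneg; linarith).mul
      (HurwitzZeta.differentiableAt_expZeta x 1 (Or.inr hx))).continuousAt
  have hpath : Tendsto (fun r : ℝ => (r : ℂ)) (𝓝[>] 1) (𝓝 1) :=
    (continuous_ofReal.tendsto' 1 1 (by simp)).mono_left nhdsWithin_le_nhds
  have := tendsto_nhds_unique (hc1.tendsto.comp hpath)
    ((hc2.tendsto.comp hpath).congr' (eventually_nhdsWithin_of_forall fun r hr =>
      (hdir r (by simpa using hr)).symm))
  rw [← hmel, this]
  simp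
end

section
open Complex ZMod

variable {N : ℕ} [NeZero N]

theorem expZeta_toAddCircle_one {j : ZMod N} (hj : j ≠ 0) :
    HurwitzZeta.expZeta (toAddCircle j) 1 = -log (1 - stdAddChar j) := by
  have h : (((j.val / N : ℝ)) : UnitAddCircle) ≠ 0 := by
    rwa [← toAddCircle_apply, Ne, toAddCircle_eq_zero]
  rw [toAddCircle_apply, expZeta_one_eq_neg_log h]
  have := stdAddChar_coe (N := N) (j.val : ℤ)
  simp only [Int.cast_natCast, natCast_zmod_val] at this
  rw [this]
  push_cast
  rw [mul_div_assoc]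

theorem norm_stdAddChar (j : ZMod N) : ‖(stdAddChar j : ℂ)‖ = 1 := by
  rw [stdAddChar_apply, Circle.norm_coe]

theorem stdAddChar_ne_one {j : ZMod N} (hj : j ≠ 0) : (stdAddChar j : ℂ) ≠ 1 := fun h =>
  hj (injective_stdAddChar (h.trans (AddChar.map_zero_eq_one _).symm))

theorem expZeta_toAddCircle_one_add_neg {j : ZMod N} (hj : j ≠ 0) :
    HurwitzZeta.expZeta (toAddCircle j) 1 + HurwitzZeta.expZeta (toAddCircle (-j)) 1 =
      -2 * (Real.log ‖1 - (stdAddChar j : ℂ)‖ : ℂ) := by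
  have hs : 1 - (stdAddChar j : ℂ) ∈ slitPlane := by
    simpa using one_sub_mul_exp_mem_slitPlane (norm_stdAddChar j) (stdAddChar_ne_one hj) le_rfl
  have hconj : (stdAddChar (-j) : ℂ) = (starRingEnd ℂ) (stdAddChar j) := by
    rw [AddChar.map_neg_eq_inv, Complex.inv_eq_conj (norm_stdAddChar j)]
  rw [expZeta_toAddCircle_one hj, expZeta_toAddCircle_one (neg_ne_zero.2 hj), hconj,
    show 1 - (starRingEnd ℂ) (stdAddChar j) = (starRingEnd ℂ) (1 - stdAddChar j) by simp,
    log_conj _ (slitPlane_arg_ne_pi hs), ← neg_add, add_conj, log_re]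
  push_cast
  ring

theorem sum_char_mul_log_one_sub_ne_zero {χ : DirichletCharacter ℂ N} (hp : χ.IsPrimitive)
    (he : χ.Even) (h1 : χ ≠ 1) :
    ∑ j : ZMod N, χ j * (Real.log ‖1 - (stdAddChar j : ℂ)‖ : ℂ) ≠ 0 := by
  have hN : N ≠ 1 := fun h => h1 (DirichletCharacter.level_one' χ h)
  have h0 : χ 0 = 0 := DirichletCharacter.map_zero' χ hN
  have hdft : ∀ k, 𝓕 χ k = gaussSum χ stdAddChar * χ⁻¹ k := fun k => by
    have hinv : χ⁻¹ (-k) = χ⁻¹ k := by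
      rw [MulChar.inv_apply_eq_inv', MulChar.inv_apply_eq_inv', he.eval_neg]
    rw [hp.fourierTransform_eq_inv_mul_gaussSum, hinv, mul_comm]
  have hgauss : gaussSum χ stdAddChar ≠ 0 := by
    intro hg
    have hz : 𝓕 (χ : ZMod N → ℂ) = 0 := by
      funext k
      rw [hdft, hg, zero_mul]; rfl
    have : (χ : ZMod N → ℂ) = 0 := (LinearEquiv.map_eq_zero_iff _).1 hz
    have := congrFun this 1
    simp at this
  have hL : ZMod.LFunction (𝓕 (χ : ZMod N → ℂ)) 1 =
      gaussSum χ stdAddChar * DirichletCharacter.LFunction χ⁻¹ 1 := by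
    simp only [DirichletCharacter.LFunction, ZMod.LFunction, hdft, Finset.mul_sum]
    exact Finset.sum_congr rfl fun _ _ => by ring
  have hsum := ZMod.LFunction_dft (χ : ZMod N → ℂ) (s := 1) (Or.inl h0)
  have hsum' : ∑ j : ZMod N, χ j * HurwitzZeta.expZeta (toAddCircle j) 1 =
      ∑ j : ZMod N, χ j * HurwitzZeta.expZeta (toAddCircle (-j)) 1 :=
    Fintype.sum_equiv (Equiv.neg _) _ _ fun j => by simp [he.eval_neg]
  have htot : ∑ j : ZMod N, χ j * (Real.log ‖1 - (stdAddChar j : ℂ)‖ : ℂ) =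
      -(gaussSum χ stdAddChar * DirichletCharacter.LFunction χ⁻¹ 1) := by
    rw [← hL, hsum]
    have : (2 : ℂ) * ∑ j : ZMod N, χ j * HurwitzZeta.expZeta (toAddCircle (-j)) 1 =
        -2 * ∑ j : ZMod N, χ j * (Real.log ‖1 - (stdAddChar j : ℂ)‖ : ℂ) := by
      rw [two_mul]
      nth_rewrite 1 [← hsum']
      rw [← Finset.sum_add_distrib, Finset.mul_sum]
      refine Finset.sum_congr rfl fun j _ => ?_
      rcases eq_or_ne j 0 with rfl | hj
      · simp [h0]
      · rw [← mul_add, expZeta_toAddCircle_one_add_neg hj]; ring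
    linear_combination this / 2
  rw [htot, neg_ne_zero]
  exact mul_ne_zero hgauss
    (DirichletCharacter.LFunction_apply_one_ne_zero (inv_ne_one.2 h1))

theorem sum_char_mul_log_one_add_ne_zero (hN : Odd N) {χ : DirichletCharacter ℂ N}
    (hp : χ.IsPrimitive) (he : χ.Even) (h2 : χ 2 ≠ 1) :
    ∑ j : ZMod N, χ j * (Real.log ‖1 + (stdAddChar j : ℂ)‖ : ℂ) ≠ 0 := by
  have hu : IsUnit (2 : ZMod N) := by
    simpa using (ZMod.isUnit_iff_coprime 2 N).2 (Nat.coprime_two_left.2 hN)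
  have h1 : χ ≠ 1 := by
    rintro rfl
    exact h2 (MulChar.one_apply hu)
  have hN1 : N ≠ 1 := fun h => h1 (DirichletCharacter.level_one' χ h)
  have h0 : χ 0 = 0 := DirichletCharacter.map_zero' χ hN1
  have hχ2 : χ 2 ≠ 0 := (hu.map χ).ne_zero
  set S := ∑ j : ZMod N, χ j * (Real.log ‖1 - (stdAddChar j : ℂ)‖ : ℂ) with hS
  have hdouble : χ 2 * ∑ j : ZMod N, χ j * (Real.log ‖1 - (stdAddChar (2 * j) : ℂ)‖ : ℂ) = S := by
    rw [hS, Finset.mul_sum]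
    refine Fintype.sum_bijective (fun j : ZMod N => 2 * j) (IsUnit.isUnit_iff_mulLeft_bijective.1 hu) _ _ ?_
    intro j
    rw [map_mul χ]; ring
  have key : ∑ j : ZMod N, χ j * (Real.log ‖1 + (stdAddChar j : ℂ)‖ : ℂ) =
      ((χ 2)⁻¹ - 1) * S := by
    rw [sub_mul, one_mul, ← hdouble, inv_mul_cancel_left₀ hχ2, hdouble, hS,
      ← Finset.sum_sub_distrib]
    refine Finset.sum_congr rfl fun j _ => ?_
    rcases eq_or_ne j 0 with rfl | hj
    · simp [h0]
    have h2j : (2 : ZMod N) * j ≠ 0 := fun h => hj (hu.mul_right_eq_zero.1 h)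
    have hfac : 1 - (stdAddChar (2 * j) : ℂ) = (1 - stdAddChar j) * (1 + stdAddChar j) := by
      rw [two_mul, AddChar.map_add_eq_mul]; ring
    have hne := sub_ne_zero.2 (stdAddChar_ne_one h2j).symm
    rw [hfac] at hne
    rw [hfac, norm_mul, Real.log_mul (norm_ne_zero_iff.2 (left_ne_zero_of_mul hne))
      (norm_ne_zero_iff.2 (right_ne_zero_of_mul hne))]
    push_cast
    ring
  rw [key]
  refine mul_ne_zero (sub_ne_zero.2 fun h => h2 ?_) (sum_char_mul_log_one_sub_ne_zero hp he h1)
  exact inv_eq_one.1 h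

end

end

section
open ZMod

theorem stdAddChar_intCast_mul {n f d : ℕ} [NeZero n] [NeZero f] (h : n = d * f) (m : ℤ) :
    (stdAddChar ((d * m : ℤ) : ZMod n) : ℂ) = stdAddChar (m : ZMod f) := by
  have hd : (d : ℂ) ≠ 0 := by
    rintro hd
    rw [Nat.cast_eq_zero.1 hd, zero_mul] at h
    exact NeZero.ne n h
  rw [stdAddChar_coe, stdAddChar_coe, h]
  congr 1
  push_cast
  rw [mul_left_comm _ (d : ℂ), mul_div_mul_left _ _ hd]

/-- The vector of logarithms of the absolute values of the conjugates of `1 + ω_n ^ j`. -/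
noncomputable def conjLog (n : ℕ) [NeZero n] (j : ZMod n) : (ZMod n)ˣ → ℂ :=
  fun a => (Real.log ‖1 + (stdAddChar (j * (a : ZMod n)) : ℂ)‖ : ℂ)

theorem inv_char_mem_span_conjLog {n : ℕ} [NeZero n] (hn : Odd n) {χ : DirichletCharacter ℂ n}
    (he : χ.Even) (h2 : χ 2 ≠ 1) :
    (fun a : (ZMod n)ˣ => χ⁻¹ a) ∈ Submodule.span ℂ (Set.range (conjLog n)) := by
  have : NeZero χ.conductor := ⟨χ.conductor_ne_zero⟩
  obtain ⟨d, hd⟩ := χ.conductor_dvd_level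
  rw [mul_comm] at hd
  have hf : Odd χ.conductor := hn.of_dvd_nat χ.conductor_dvd_level
  set ψ := χ.primitiveCharacter
  have hψe : ψ.Even := by
    have := χ.primitiveCharacter_apply_of_isCoprime (a := -1) (by simp [IsCoprime.neg_left_iff, isCoprime_one_left])
    push_cast at this
    exact this.trans he
  have hψ2 : ψ 2 ≠ 1 := by
    have := χ.primitiveCharacter_apply_of_isCoprime (a := 2)
      (Nat.isCoprime_iff_coprime.2 (Nat.coprime_two_left.2 hn))
    push_cast at this
    rwa [this]
  set T := ∑ j : ZMod χ.conductor, ψ j * (Real.log ‖1 + (stdAddChar j : ℂ)‖ : ℂ) with hTdef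
  have hT : T ≠ 0 := sum_char_mul_log_one_add_ne_zero hf χ.primitiveCharacter_isPrimitive hψe hψ2
  have hsum : (fun a : (ZMod n)ˣ => χ⁻¹ a) =
      T⁻¹ • ∑ b : ZMod χ.conductor, ψ b • conjLog n ((d * (b.val : ℤ) : ℤ) : ZMod n) := by
    funext a
    obtain ⟨m, hm⟩ := ZMod.intCast_surjective (a : ZMod n)
    have hcop : IsCoprime m n := ((ZMod.coe_int_isUnit_iff_isCoprime m n).1 (hm ▸ a.isUnit)).symm
    have hunit : IsUnit (m : ZMod χ.conductor) := by
      rw [ZMod.coe_int_isUnit_iff_isCoprime]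
      exact (hcop.of_isCoprime_of_dvd_right
        (Int.natCast_dvd_natCast.2 χ.conductor_dvd_level)).symm
    have hψm : ψ m = χ m := χ.primitiveCharacter_apply_of_isCoprime hcop
    have hχm : χ m ≠ 0 := (hm ▸ a.isUnit.map χ).ne_zero
    have hterm : ∀ b : ZMod χ.conductor, conjLog n ((d * (b.val : ℤ) : ℤ) : ZMod n) a =
        (Real.log ‖1 + (stdAddChar (b * (m : ZMod χ.conductor)) : ℂ)‖ : ℂ) := fun b => by
      have := stdAddChar_intCast_mul hd ((b.val : ℤ) * m)
      push_cast [natCast_zmod_val] at this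
      rw [conjLog, ← hm, ← this]
      push_cast
      rw [mul_assoc]
    have hshift : T = χ m * ∑ b, ψ b * (Real.log ‖1 + (stdAddChar (b * (m : ZMod χ.conductor)) : ℂ)‖ : ℂ) := by
      rw [hTdef, Finset.mul_sum]
      symm
      refine Fintype.sum_bijective (fun b => b * (m : ZMod χ.conductor))
        (IsUnit.isUnit_iff_mulRight_bijective.1 hunit) _ _ fun b => ?_
      rw [map_mul ψ, hψm]
      ring
    simp only [Pi.smul_apply, Finset.sum_apply, smul_eq_mul, hterm]
    rw [MulChar.inv_apply_eq_inv', ← hm, eq_inv_mul_iff_mul_eq₀ hT, hshift]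
    field_simp
  rw [hsum]
  exact Submodule.smul_mem _ _ (Submodule.sum_mem _ fun b _ => Submodule.smul_mem _ _
    (Submodule.subset_span ⟨_, rfl⟩))

theorem conjLog_zero (n : ℕ) [NeZero n] : conjLog n 0 = fun _ => (Real.log 2 : ℂ) := by
  funext a
  norm_num [conjLog]

end

theorem card_le_rank_of_mem_span_range {A V ι : Type} [AddCommGroup A] [AddCommGroup V]
    [Module ℂ V] (Λ : A →+ V) {v : ι → V} (hv : LinearIndependent ℂ v)
    (hmem : ∀ i, v i ∈ Submodule.span ℂ (Set.range Λ)) :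
    Cardinal.mk ι ≤ Module.rank ℤ A := by
  obtain ⟨t, ht, hspan, hli⟩ := exists_linearIndependent ℂ (Set.range Λ)
  choose g hg using fun x : t => ht x.2
  have hgli : LinearIndependent ℤ g := by
    refine LinearIndependent.of_comp Λ.toIntLinearMap ?_
    have : (Λ.toIntLinearMap ∘ g) = ((↑) : t → V) := funext hg
    rw [this]
    exact hli.restrict_scalars (R := ℤ) fun a b h => by simpa using h
  refine le_trans ?_ hgli.cardinal_le_rank
  refine le_trans ?_ (rank_span_le (R := ℂ) t)
  rw [hspan]
  refine LinearIndependent.cardinal_le_rank (v := fun i => (⟨v i, hmem i⟩ : Submodule.span ℂ (Set.range Λ))) ?_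
  exact LinearIndependent.of_comp (Submodule.subtype _) hv

theorem rank_Kgroup_one : Module.rank ℤ (Additive ↥(Kgroup 1)) = 1 := by
  set u : ℂˣ := Units.mk0 2 two_ne_zero with hu
  have hK : Kgroup 1 = Subgroup.zpowers u := by
    rw [Kgroup, Subgroup.zpowers_eq_closure]
    congr 1
    ext x
    simp [hu, Units.ext_iff, one_add_one_eq_two]
  rw [hK]
  let g : Additive ↥(Subgroup.zpowers u) := Additive.ofMul ⟨u, Subgroup.mem_zpowers u⟩
  have hbij : Function.Bijective (LinearMap.toSpanSingleton ℤ _ g) := by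
    constructor
    · rw [injective_iff_map_eq_zero]
      intro k hk
      have h1 : u ^ k = 1 := congrArg (fun x => ((Additive.toMul x : Subgroup.zpowers u) : ℂˣ)) hk
      have h2 : (2 : ℝ) ^ k = 1 := by
        have := congrArg (fun x : ℂˣ => (x : ℂ)) h1
        simp only [hu, Units.val_zpow_eq_zpow_val, Units.val_mk0, Units.val_one] at this
        simpa using congrArg (fun z : ℂ => ‖z‖) this
      exact (zpow_eq_one_iff_right₀ (by norm_num) (by norm_num)).1 h2
    · rintro ⟨x, k, rfl⟩
      exact ⟨k, rfl⟩
  rw [← (LinearEquiv.ofBijective _ hbij).rank_eq]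
  exact Module.rank_self ℤ

section
variable {n : ℕ} [NeZero n]

theorem isPrimitiveRoot_stdAddChar_unit (a : (ZMod n)ˣ) :
    IsPrimitiveRoot (ZMod.stdAddChar (a : ZMod n) : ℂ) n := by
  have h1 : IsPrimitiveRoot (ZMod.stdAddChar (1 : ZMod n) : ℂ) n := by
    have := ZMod.stdAddChar_coe (N := n) 1
    push_cast at this
    rw [this, mul_one]
    exact Complex.isPrimitiveRoot_exp n (NeZero.ne n)
  have := h1.pow_of_coprime (a : ZMod n).val (ZMod.val_coe_unit_coprime a)
  rwa [← AddChar.map_nsmul_eq_pow, nsmul_eq_mul, mul_one, ZMod.natCast_zmod_val] at this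

theorem IsCyclotomicExtension.exists_ringHom_zeta_eq (n : ℕ) [NeZero n] (L : Type)
    [Field L] [Algebra ℚ L] [IsCyclotomicExtension {n} ℚ L] (a : (ZMod n)ˣ) :
    ∃ φ : L →+* ℂ, φ (IsCyclotomicExtension.zeta n ℚ L) = ZMod.stdAddChar (a : ZMod n) := by
  have hζ := IsCyclotomicExtension.zeta_spec n ℚ L
  have hirr := Polynomial.cyclotomic.irreducible_rat (NeZero.pos n)
  let e := hζ.embeddingsEquivPrimitiveRoots ℂ hirr
  refine ⟨(e.symm ⟨_, (mem_primitiveRoots (NeZero.pos n)).2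
    (isPrimitiveRoot_stdAddChar_unit a)⟩ : L →ₐ[ℚ] ℂ), ?_⟩
  exact (hζ.embeddingsEquivPrimitiveRoots_apply_coe ℂ hirr _).symm.trans
    (congrArg Subtype.val (e.apply_symm_apply _))

theorem exists_field_conjugations (n : ℕ) [NeZero n] :
    ∃ (L : Type) (_ : Field L) (ζ : L), ∀ a : (ZMod n)ˣ,
      ∃ φ : L →+* ℂ, φ ζ = ZMod.stdAddChar (a : ZMod n) :=
  let _ : Algebra ℚ (CyclotomicField n ℚ) := CyclotomicField.algebra n ℚ
  ⟨CyclotomicField n ℚ, inferInstance, _, fun a =>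
    @IsCyclotomicExtension.exists_ringHom_zeta_eq n _ (CyclotomicField n ℚ) _ _
      (CyclotomicField.isCyclotomicExtension n ℚ) a⟩

theorem one_add_stdAddChar_ne_zero (hn : Odd n) (j : ZMod n) :
    1 + (ZMod.stdAddChar j : ℂ) ≠ 0 := by
  intro h
  have h1 : (ZMod.stdAddChar j : ℂ) = -1 := by linear_combination h
  have h2 : (ZMod.stdAddChar j : ℂ) ^ n = 1 := by
    rw [← AddChar.map_nsmul_eq_pow]
    simp
  rw [h1, hn.neg_one_pow] at h2
  norm_num at h2

theorem omegaC_pow_val (j : ZMod n) : omegaC n ^ j.val = ZMod.stdAddChar j := by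
  have := ZMod.stdAddChar_coe (N := n) 1
  push_cast at this
  rw [omegaC, ← mul_one (2 * (Real.pi : ℂ) * Complex.I), ← this, ← AddChar.map_nsmul_eq_pow,
    nsmul_eq_mul, mul_one, ZMod.natCast_zmod_val]

/-- The logarithmic embedding attached to a family of complex embeddings. -/
noncomputable def logEmbedding {L ι : Type} [Field L] (φ : ι → L →+* ℂ) :
    Additive Lˣ →+ (ι → ℂ) where
  toFun u a := (Real.log ‖φ a (Additive.toMul u : Lˣ)‖ : ℂ)
  map_zero' := by
    funext a
    simp
  map_add' u v := by
    funext a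
    simp only [toMul_add, Units.val_mul, map_mul, norm_mul, Pi.add_apply]
    rw [Real.log_mul (by simp) (by simp)]
    push_cast
    rfl

theorem map_one_add_pow {L : Type} [Field L] {ζ : L}
    {φ : (ZMod n)ˣ → L →+* ℂ} (hφ : ∀ a : (ZMod n)ˣ, φ a ζ = ZMod.stdAddChar (a : ZMod n))
    (a : (ZMod n)ˣ) (j : ZMod n) :
    φ a (1 + ζ ^ j.val) = 1 + ZMod.stdAddChar (j * (a : ZMod n)) := by
  rw [map_add, map_one, map_pow, hφ, ← AddChar.map_nsmul_eq_pow, nsmul_eq_mul,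
    ZMod.natCast_zmod_val]

theorem rank_comap_units_map_le {L : Type} [Field L] (φ : L →+* ℂ) (K : Subgroup ℂˣ) :
    Module.rank ℤ (Additive ↥(K.comap (Units.map (φ : L →* ℂ)))) ≤
      Module.rank ℤ (Additive ↥K) := by
  have hr : Function.Injective ((Units.map (φ : L →* ℂ)).subgroupComap K) := by
    intro x y hxy
    have := congrArg Subtype.val hxy
    exact Subtype.ext (Units.map_injective φ.injective this)
  exact LinearMap.rank_le_of_injective
    (MonoidHom.toAdditive ((Units.map (φ : L →* ℂ)).subgroupComap K)).toIntLinearMap hr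

theorem conjLog_mem_range_logEmbedding (hn : Odd n) {L : Type} [Field L] {ζ : L}
    {φ : (ZMod n)ˣ → L →+* ℂ} (hφ : ∀ a : (ZMod n)ˣ, φ a ζ = ZMod.stdAddChar (a : ZMod n))
    (j : ZMod n) :
    conjLog n j ∈ Set.range ((logEmbedding φ).comp (MonoidHom.toAdditive
      ((Kgroup n).comap (Units.map (φ 1 : L →* ℂ))).subtype)) := by
  have hne : 1 + ζ ^ j.val ≠ 0 := fun h =>
    one_add_stdAddChar_ne_zero hn (j * ((1 : (ZMod n)ˣ) : ZMod n)) (by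
      rw [← map_one_add_pow hφ, h, map_zero])
  have hmem : Units.mk0 _ hne ∈ (Kgroup n).comap (Units.map (φ 1 : L →* ℂ)) := by
    refine Subgroup.mem_comap.2 (Subgroup.subset_closure ⟨j.val, ZMod.val_lt j, ?_⟩)
    rw [omegaC_pow_val]
    simpa using map_one_add_pow hφ 1 j
  refine ⟨Additive.ofMul ⟨_, hmem⟩, ?_⟩
  funext a
  rw [conjLog, ← map_one_add_pow hφ]
  rfl

theorem card_le_rank_Kgroup (hn : Odd n) {ι : Type} {v : ι → (ZMod n)ˣ → ℂ}
    (hv : LinearIndependent ℂ v)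
    (hmem : ∀ i, v i ∈ Submodule.span ℂ (Set.range (conjLog n))) :
    Cardinal.mk ι ≤ Module.rank ℤ (Additive ↥(Kgroup n)) := by
  obtain ⟨L, _, ζ, h⟩ := exists_field_conjugations n
  choose φ hφ using h
  refine le_trans (card_le_rank_of_mem_span_range ((logEmbedding φ).comp (MonoidHom.toAdditive
      ((Kgroup n).comap (Units.map (φ 1 : L →* ℂ))).subtype)) hv fun i => ?_)
    (rank_comap_units_map_le (φ 1) (Kgroup n))
  refine Submodule.span_mono ?_ (hmem i)
  rintro _ ⟨j, rfl⟩
  exact conjLog_mem_range_logEmbedding hn hφ j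

theorem monoidHom_mem_span_conjLog (hn : Odd n) {ψ : (ZMod n)ˣ →* ℂˣ} (hneg : ψ (-1) = 1)
    {t : (ZMod n)ˣ} (ht : (t : ZMod n) = 2) (h : ψ t ≠ 1 ∨ ψ = 1) :
    (fun a => (ψ a : ℂ)) ∈ Submodule.span ℂ (Set.range (conjLog n)) := by
  rcases h with h | rfl
  · let χ : DirichletCharacter ℂ n := MulChar.ofUnitHom ψ⁻¹
    have hχ : ∀ a : (ZMod n)ˣ, χ a = (ψ a : ℂ)⁻¹ := fun a => by
      simp [χ]
    have he : χ.Even := by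
      have := hχ (-1)
      simpa [hneg, DirichletCharacter.Even] using this
    have h2 : χ 2 ≠ 1 := by
      rw [← ht, hχ]
      simpa using h
    convert inv_char_mem_span_conjLog hn he h2 using 2 with a
    rw [MulChar.inv_apply_eq_inv', hχ, inv_inv]
  · have hlog : (Real.log 2 : ℂ) ≠ 0 := by
      exact_mod_cast (Real.log_pos one_lt_two).ne'
    have : (fun a : (ZMod n)ˣ => (((1 : (ZMod n)ˣ →* ℂˣ) a : ℂˣ) : ℂ)) =
        (Real.log 2 : ℂ)⁻¹ • conjLog n 0 := by
      rw [conjLog_zero]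
      funext a
      simp only [MonoidHom.one_apply, Units.val_one, Pi.smul_apply, smul_eq_mul]
      rw [inv_mul_cancel₀ hlog]
    rw [this]
    exact Submodule.smul_mem _ _ (Submodule.subset_span ⟨0, rfl⟩)

theorem linearIndependent_monoidHom_units (G : Type) [Group G] :
    LinearIndependent ℂ (fun (ψ : G →* ℂˣ) (a : G) => (ψ a : ℂ)) :=
  (linearIndependent_monoidHom G ℂ).comp (fun ψ : G →* ℂˣ => (Units.coeHom ℂ).comp ψ)
    fun _ _ h => MonoidHom.ext fun a => Units.ext (DFunLike.congr_fun h a)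

end

theorem Upow_spec {n : ℕ} (hodd : Odd n) :
    1 ≤ Upow n ∧ ((2 : ZMod n) ^ Upow n = 1 ∨ (2 : ZMod n) ^ Upow n = -1) := by
  refine Nat.sInf_mem (s := {k : ℕ | 1 ≤ k ∧ ((2 : ZMod n) ^ k = 1 ∨ (2 : ZMod n) ^ k = -1)})
    ⟨n.totient, Nat.totient_pos.2 hodd.pos, Or.inl ?_⟩
  have h := ZMod.pow_totient (ZMod.unitOfCoprime 2 (Nat.coprime_two_left.2 hodd))
  have h' := congrArg Units.val h
  rw [Units.val_pow_eq_pow_val, ZMod.coe_unitOfCoprime] at h'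
  exact_mod_cast h'

theorem two_pow_ne_neg_two_pow {n : ℕ} (h3 : 3 ≤ n) (hodd : Odd n) {i j : ℕ} (hi : i < Upow n)
    (hj : j < Upow n) : (2 : ZMod n) ^ i ≠ -2 ^ j := by
  wlog hij : i ≤ j generalizing i j
  · exact fun h => this hj hi (by omega) (by rw [h, neg_neg])
  intro h
  have hu : IsUnit (2 : ZMod n) := by
    simpa using (ZMod.isUnit_iff_coprime 2 n).2 (Nat.coprime_two_left.2 hodd)
  obtain ⟨d, rfl⟩ := Nat.exists_eq_add_of_le hij
  have hd : (2 : ZMod n) ^ d = -1 := by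
    apply (hu.pow i).mul_left_cancel
    rw [← pow_add, mul_neg_one, h, neg_neg]
  rcases Nat.eq_zero_or_pos d with rfl | hpos
  · have : Fact (2 < n) := ⟨h3⟩
    exact ZMod.neg_one_ne_one (n := n) (by simpa using hd.symm)
  · have : Upow n ≤ d := Nat.sInf_le ⟨hpos, Or.inr hd⟩
    omega

theorem two_mul_card_Uset_le {n : ℕ} (h3 : 3 ≤ n) (hodd : Odd n) {t : (ZMod n)ˣ}
    (ht : (t : ZMod n) = 2) {H : Subgroup (ZMod n)ˣ} (hneg : -1 ∈ H) (htH : t ∈ H) :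
    2 * (Uset n).card ≤ Nat.card H := by
  classical
  have : NeZero n := ⟨by omega⟩
  let V : Finset (ZMod n) := (Uset n).image Neg.neg
  have hV : V.card = (Uset n).card := Finset.card_image_of_injective _ neg_injective
  have hdisj : Disjoint (Uset n) V := by
    rw [Finset.disjoint_left]
    intro x hx hxV
    simp only [V, Uset, Finset.mem_image, Finset.mem_range] at hx hxV
    obtain ⟨i, hi, rfl⟩ := hx
    obtain ⟨_, ⟨j, hj, rfl⟩, h⟩ := hxV
    exact two_pow_ne_neg_two_pow h3 hodd hi hj h.symm
  have hsub : ((Uset n ∪ V : Finset (ZMod n)) : Set (ZMod n)) ⊆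
      (fun x : (ZMod n)ˣ => (x : ZMod n)) '' (H : Set (ZMod n)ˣ) := by
    intro x hx
    simp only [V, Uset, Finset.coe_union, Finset.coe_image, Set.mem_union, Set.mem_image,
      Finset.mem_coe, Finset.mem_range] at hx
    rcases hx with ⟨i, -, rfl⟩ | ⟨_, ⟨i, -, rfl⟩, rfl⟩
    · exact ⟨t ^ i, H.pow_mem htH i, by simp [ht]⟩
    · exact ⟨-1 * t ^ i, H.mul_mem hneg (H.pow_mem htH i), by simp [ht]⟩
  have := Set.ncard_le_ncard hsub (Set.toFinite _)
  rw [Set.ncard_coe_finset, Finset.card_union_of_disjoint hdisj, hV,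
    Set.ncard_image_of_injective _ Units.val_injective] at this
  rw [two_mul]
  exact this

theorem ncard_trivial_on_mul_card {G : Type} [CommGroup G] [Finite G] (H : Subgroup G) :
    {ψ : G →* ℂˣ | ∀ x ∈ H, ψ x = 1}.ncard * Nat.card H = Nat.card G := by
  rw [H.card_eq_card_quotient_mul_card_subgroup, ← CommGroup.card_domRestrictHom_ker (M := ℂ) H]
  congr 1
  refine congrArg Nat.card (congrArg (fun s : Set (G →* ℂˣ) => (s : Type)) ?_)
  ext ψ
  simp only [Set.mem_ofPred_eq, SetLike.mem_coe, MonoidHom.mem_ker]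
  refine ⟨fun h => MonoidHom.ext fun x => h x x.2, fun h x hx => DFunLike.congr_fun h ⟨x, hx⟩⟩

theorem le_ncard_characters {n : ℕ} (h3 : 3 ≤ n) (hodd : Odd n) {t : (ZMod n)ˣ}
    (ht : (t : ZMod n) = 2) :
    Nat.totient n / 2 - (Nat.totient n / (2 * (Uset n).card) - 1) ≤
      {ψ : (ZMod n)ˣ →* ℂˣ | ψ (-1) = 1 ∧ (ψ t ≠ 1 ∨ ψ = 1)}.ncard := by
  have : NeZero n := ⟨by omega⟩
  have : Fact (2 < n) := ⟨h3⟩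
  have hG : Nat.card (ZMod n)ˣ = n.totient := by
    rw [Nat.card_eq_fintype_card, ZMod.card_units_eq_totient]
  have : Finite ((ZMod n)ˣ →* ℂˣ) := Nat.finite_of_card_ne_zero (by
    rw [CommGroup.card_monoidHom_of_hasEnoughRootsOfUnity]
    exact Nat.card_pos.ne')
  set A := {ψ : (ZMod n)ˣ →* ℂˣ | ∀ x ∈ Subgroup.zpowers (-1 : (ZMod n)ˣ), ψ x = 1} with hA
  set H := Subgroup.closure {-1, t} with hH
  set B := {ψ : (ZMod n)ˣ →* ℂˣ | ∀ x ∈ H, ψ x = 1} with hB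
  have hnegH : -1 ∈ H := Subgroup.subset_closure (by simp)
  have htH : t ∈ H := Subgroup.subset_closure (by simp)
  have hBA : B ⊆ A := fun ψ hψ x hx =>
    hψ x ((Subgroup.zpowers_le (H := H)).2 hnegH hx)
  have hAcard : A.ncard * 2 = n.totient := by
    have := ncard_trivial_on_mul_card (Subgroup.zpowers (-1 : (ZMod n)ˣ))
    rwa [Nat.card_zpowers, orderOf_eq_prime (p := 2) (by simp) (fun h =>
      ZMod.neg_one_ne_one (n := n) (by simpa using congrArg Units.val h)), hG] at this
  have hBcard : B.ncard * Nat.card H = n.totient := hG ▸ ncard_trivial_on_mul_card H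
  have hUcard : 0 < (Uset n).card := by
    rw [Finset.card_pos, Uset, Finset.image_nonempty, Finset.nonempty_range_iff]
    have := (Upow_spec hodd).1
    omega
  have hBle : B.ncard ≤ n.totient / (2 * (Uset n).card) := by
    rw [Nat.le_div_iff_mul_le (by omega), ← hBcard]
    exact Nat.mul_le_mul_left _ (two_mul_card_Uset_le h3 hodd ht hnegH htH)
  have h1B : (1 : (ZMod n)ˣ →* ℂˣ) ∈ B := fun _ _ => rfl
  have hBpos : 0 < B.ncard := (Set.ncard_pos (Set.toFinite _)).2 ⟨1, h1B⟩
  have hins : insert 1 (A \ B) ⊆ {ψ : (ZMod n)ˣ →* ℂˣ | ψ (-1) = 1 ∧ (ψ t ≠ 1 ∨ ψ = 1)} := by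
    rintro ψ (rfl | ⟨hψA, hψB⟩)
    · simp
    · have hneg : ψ (-1) = 1 := hψA _ (Subgroup.mem_zpowers _)
      refine ⟨hneg, Or.inl fun h => hψB ?_⟩
      have : H ≤ ψ.ker := (Subgroup.closure_le _).2 (by
        rintro x (rfl | rfl)
        · exact hneg
        · exact h)
      exact fun x hx => this hx
  have hle := Set.ncard_le_ncard hins (Set.toFinite _)
  rw [Set.ncard_insert_of_notMem (fun h => h.2 h1B) (Set.toFinite _)] at hle
  have hdiff := Set.ncard_sdiff_add_ncard_of_subset hBA (Set.toFinite _)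
  omega

theorem stmt11 (n : ℕ) (h3 : 3 ≤ n) (hodd : Odd n) :
    ((Nat.totient n / 2 - (Nat.totient n / (2 * (Uset n).card) - 1) : ℕ) : Cardinal) ≤
      Module.rank ℤ (Additive ↥(Kgroup n)) ∧
    Module.rank ℤ (Additive ↥(Kgroup 1)) = 1 := by
  refine ⟨?_, rank_Kgroup_one⟩
  have : NeZero n := ⟨by omega⟩
  let t : (ZMod n)ˣ := ZMod.unitOfCoprime 2 (Nat.coprime_two_left.2 hodd)
  have ht : (t : ZMod n) = 2 := by simp [t]
  set S := {ψ : (ZMod n)ˣ →* ℂˣ | ψ (-1) = 1 ∧ (ψ t ≠ 1 ∨ ψ = 1)} with hS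
  have hrank := card_le_rank_Kgroup hodd
    ((linearIndependent_monoidHom_units (ZMod n)ˣ).comp ((↑) : S → _) Subtype.val_injective)
    fun ψ => monoidHom_mem_span_conjLog hodd ψ.2.1 ht ψ.2.2
  refine le_trans ?_ hrank
  refine le_trans (Nat.cast_le.2 (le_ncard_characters h3 hodd ht)) ?_
  exact Cardinal.natCast_toNat_le _
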